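/- For every ρ > 0, (2/(√π (2π)^{5/2})) ∫_ρ^∞ (1/√(cosh r − cosh ρ)) · (1/(r² sinh r) + cosh r/(r sinh² r)) dr ≤ 1/(16π²(1 + cosh ρ) sinh³(ρ/2)) + √2/(4π² √(1 + cosh ρ) · sinh ρ). -/

import Mathlib

open MeasureTheory Real

noncomputable section

/-- The kernel of `(-Δ_ℍ - 9/4)^{-1/2}` on 4-dimensional hyperbolic space, as a
function of the geodesic distance `ρ`. -/
def Ghalf (ρ : ℝ) : ℝ :=
  (2 / (Real.sqrt π * (2 * π) ^ ((5 : ℝ) / 2))) *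
    ∫ r in Set.Ioi ρ,
      (1 / Real.sqrt (Real.cosh r - Real.cosh ρ)) *
        (1 / (r ^ 2 * Real.sinh r) + Real.cosh r / (r * Real.sinh r ^ 2))

end

open Filter Topology in
theorem tendsto_sinh_half_atTop : Tendsto (fun r : ℝ => Real.sinh (r / 2)) atTop atTop := by
  refine tendsto_atTop_mono' _ ?_ (tendsto_id.atTop_div_const (show (0 : ℝ) < 2 by norm_num))
  filter_upwards [eventually_ge_atTop (0 : ℝ)] with r hr
  exact Real.self_le_sinh_iff.2 (by simp only [id]; positivity)

theorem sinh_le_mul_cosh {t : ℝ} (ht : 0 ≤ t) : Real.sinh t ≤ t * Real.cosh t := by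
  have hd : ∀ x : ℝ, HasDerivAt (fun x => x * Real.cosh x - Real.sinh x) (x * Real.sinh x) x := by
    intro x
    have h := ((hasDerivAt_id x).mul (Real.hasDerivAt_cosh x)).sub (Real.hasDerivAt_sinh x)
    refine h.congr_deriv ?_
    simp
  have hm : MonotoneOn (fun x => x * Real.cosh x - Real.sinh x) (Set.Ici 0) := by
    refine monotoneOn_of_deriv_nonneg (convex_Ici 0) (by fun_prop) (by fun_prop) ?_
    intro x hx
    rw [interior_Ici] at hx
    rw [(hd x).deriv]
    exact mul_nonneg (le_of_lt hx) (Real.sinh_nonneg_iff.2 (le_of_lt hx))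
  have := hm (Set.self_mem_Ici) ht ht
  simp at this
  linarith

/-- The square root of `sinh² (r / 2) - a²`. -/
noncomputable def radial (a r : ℝ) : ℝ := Real.sqrt (Real.sinh (r / 2) ^ 2 - a ^ 2)

/-- A primitive, in the variable `r`, of the majorant of the integrand of `Ghalf`
(up to the factor `1 / (4 √2)`). -/
noncomputable def majorantPrimitive (a k r : ℝ) : ℝ :=
  radial a r / (a ^ 2 * Real.sinh (r / 2) ^ 2) + Real.arctan (radial a r / a) * (1 / a ^ 3 + 1 / a)
    - Real.arctan (radial a r / k) / k

/-- The derivative of `majorantPrimitive`. -/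
noncomputable def majorant (a r : ℝ) : ℝ :=
  Real.cosh (r / 2) / (2 * radial a r) *
    (2 / Real.sinh (r / 2) ^ 3 + 1 / Real.sinh (r / 2)
      - Real.sinh (r / 2) / Real.cosh (r / 2) ^ 2)

theorem continuous_radial (a : ℝ) : Continuous (radial a) := by
  unfold radial; fun_prop

theorem hasDerivAt_majorantPrimitive {a k r : ℝ} (ha : 0 < a) (hk : 0 < k)
    (hak : k ^ 2 = 1 + a ^ 2) (hr : a < Real.sinh (r / 2)) :
    HasDerivAt (majorantPrimitive a k) (majorant a r) r := by
  have hs0 : 0 < Real.sinh (r / 2) := ha.trans hr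
  have hpos : 0 < Real.sinh (r / 2) ^ 2 - a ^ 2 := by nlinarith
  have hs : HasDerivAt (fun r : ℝ => Real.sinh (r / 2)) (Real.cosh (r / 2) * (1 / 2)) r :=
    ((hasDerivAt_id r).div_const 2).sinh
  have hw : HasDerivAt (radial a)
      (Real.sinh (r / 2) * Real.cosh (r / 2) / (2 * radial a r)) r := by
    have h := ((hs.pow 2).sub_const (a ^ 2)).sqrt hpos.ne'
    refine h.congr_deriv ?_
    simp [radial]
    ring
  have hw0 : 0 < radial a r := Real.sqrt_pos.2 hpos
  have hw2 : Real.sinh (r / 2) ^ 2 = radial a r ^ 2 + a ^ 2 := by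
    rw [radial, Real.sq_sqrt hpos.le]; ring
  have hc2 : Real.cosh (r / 2) ^ 2 = radial a r ^ 2 + k ^ 2 := by
    rw [Real.cosh_sq, hw2, hak]; ring
  have h1 := hw.div ((hs.pow 2).const_mul (a ^ 2))
    (by simp only [Pi.pow_apply]; positivity)
  have h2 := ((hw.div_const a).arctan).mul_const (1 / a ^ 3 + 1 / a)
  have h3 := ((hw.div_const k).arctan).div_const k
  refine ((h1.add h2).sub h3).congr_deriv ?_
  have e2 : 1 / (1 + (radial a r / a) ^ 2) = a ^ 2 / Real.sinh (r / 2) ^ 2 := by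
    rw [hw2, div_pow]; field_simp; ring
  have e3 : 1 / (1 + (radial a r / k) ^ 2) = k ^ 2 / Real.cosh (r / 2) ^ 2 := by
    rw [hc2, div_pow]; field_simp; ring
  rw [e2, e3, majorant]
  have hc0 := Real.cosh_pos (r / 2)
  simp only [Pi.pow_apply]
  generalize Real.sinh (r / 2) = s at *
  generalize Real.cosh (r / 2) = c at *
  generalize radial a r = w at *
  have ha2 : 2 * s ^ 2 - 2 * w ^ 2 = 2 * a ^ 2 := by linarith
  trans c / (2 * w) * ((2 * s ^ 2 - 2 * w ^ 2) / (a ^ 2 * s ^ 3) + 1 / s - s / c ^ 2)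
  · field_simp
    ring
  · rw [ha2]
    field_simp

open Filter Topology in
theorem tendsto_majorantPrimitive {a k : ℝ} (ha : 0 < a) (hk : 0 < k) :
    Tendsto (majorantPrimitive a k) atTop
      (𝓝 (π / 2 * (1 / a ^ 3 + 1 / a) - π / 2 / k)) := by
  have hs := tendsto_sinh_half_atTop
  have hw : Tendsto (radial a) atTop atTop := by
    refine Real.tendsto_sqrt_atTop.comp ?_
    exact tendsto_atTop_add_const_right _ _ ((tendsto_pow_atTop two_ne_zero).comp hs)
  have harc (b : ℝ) (hb : 0 < b) :
      Tendsto (fun r => Real.arctan (radial a r / b)) atTop (𝓝 (π / 2)) :=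
    (tendsto_nhds_of_tendsto_nhdsWithin Real.tendsto_arctan_atTop).comp
      (hw.atTop_div_const hb)
  have h0 : Tendsto (fun r => radial a r / (a ^ 2 * Real.sinh (r / 2) ^ 2)) atTop (𝓝 0) := by
    have hlim : Tendsto (fun r : ℝ => 1 / a ^ 2 * (Real.sinh (r / 2))⁻¹) atTop (𝓝 0) := by
      simpa only [mul_zero, Function.comp_def] using
        (tendsto_inv_atTop_zero.comp hs).const_mul (1 / a ^ 2)
    refine squeeze_zero' ?_ ?_ hlim
    · exact Eventually.of_forall fun r => by unfold radial; positivity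
    · filter_upwards [hs.eventually_gt_atTop 0] with r hr
      have : radial a r ≤ Real.sinh (r / 2) := by
        rw [radial, Real.sqrt_le_left hr.le]
        nlinarith
      calc radial a r / (a ^ 2 * Real.sinh (r / 2) ^ 2)
          ≤ Real.sinh (r / 2) / (a ^ 2 * Real.sinh (r / 2) ^ 2) := by gcongr
        _ = _ := by field_simp
  have h := (h0.add ((harc a ha).mul_const (1 / a ^ 3 + 1 / a))).sub ((harc k hk).div_const k)
  rwa [zero_add] at h

theorem majorant_nonneg {a r : ℝ} (hr : 0 < r) : 0 ≤ majorant a r := by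
  have hs : 0 < Real.sinh (r / 2) := Real.sinh_pos_iff.2 (by linarith)
  have hc := Real.cosh_pos (r / 2)
  have hcs := Real.cosh_sq (r / 2)
  refine mul_nonneg (div_nonneg hc.le (mul_nonneg zero_le_two (Real.sqrt_nonneg _))) ?_
  have h : Real.sinh (r / 2) / Real.cosh (r / 2) ^ 2 ≤ 1 / Real.sinh (r / 2) := by
    rw [div_le_div_iff₀ (by positivity) hs]
    nlinarith
  have : 0 < 2 / Real.sinh (r / 2) ^ 3 := by positivity
  linarith

theorem Ghalf_integrand_le {ρ r : ℝ} (hρ : 0 < ρ) (hr : ρ < r) :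
    (1 / Real.sqrt (Real.cosh r - Real.cosh ρ)) *
        (1 / (r ^ 2 * Real.sinh r) + Real.cosh r / (r * Real.sinh r ^ 2)) ≤
      1 / (4 * Real.sqrt 2) * majorant (Real.sinh (ρ / 2)) r := by
  have hr0 : 0 < r := hρ.trans hr
  have hs : 0 < Real.sinh (r / 2) := Real.sinh_pos_iff.2 (by linarith)
  have hc := Real.cosh_pos (r / 2)
  have hcs := Real.cosh_sq (r / 2)
  have hlt : Real.sinh (ρ / 2) < Real.sinh (r / 2) := Real.sinh_lt_sinh.2 (by linarith)
  have hσ : 0 < Real.sinh (ρ / 2) := Real.sinh_pos_iff.2 (by linarith)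
  have hw : 0 < radial (Real.sinh (ρ / 2)) r := Real.sqrt_pos.2 (by nlinarith)
  have hcosh (x : ℝ) : Real.cosh x = 1 + 2 * Real.sinh (x / 2) ^ 2 := by
    have := Real.cosh_two_mul (x / 2)
    rw [mul_div_cancel₀ x two_ne_zero, Real.cosh_sq] at this
    linarith
  have hsinh : Real.sinh r = 2 * Real.sinh (r / 2) * Real.cosh (r / 2) := by
    rw [← Real.sinh_two_mul, mul_div_cancel₀ r two_ne_zero]
  have hsqrt : Real.sqrt (Real.cosh r - Real.cosh ρ)
      = Real.sqrt 2 * radial (Real.sinh (ρ / 2)) r := by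
    rw [radial, ← Real.sqrt_mul zero_le_two, hcosh r, hcosh ρ]
    congr 1; ring
  have hinv : 1 / r ≤ Real.cosh (r / 2) / (2 * Real.sinh (r / 2)) := by
    rw [div_le_div_iff₀ hr0 (by positivity)]
    have := sinh_le_mul_cosh (show 0 ≤ r / 2 by positivity)
    linarith
  have hr2 : (1 / r) ^ 2 ≤ (Real.cosh (r / 2) / (2 * Real.sinh (r / 2))) ^ 2 := by
    gcongr
  rw [hsqrt, hsinh, hcosh r, majorant]
  calc _ = 1 / (Real.sqrt 2 * radial (Real.sinh (ρ / 2)) r) *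
        ((1 / r) ^ 2 * (1 / (2 * Real.sinh (r / 2) * Real.cosh (r / 2))) +
        (1 / r) * ((1 + 2 * Real.sinh (r / 2) ^ 2) /
          (2 * Real.sinh (r / 2) * Real.cosh (r / 2)) ^ 2)) := by
        field_simp
    _ ≤ 1 / (Real.sqrt 2 * radial (Real.sinh (ρ / 2)) r) *
        ((Real.cosh (r / 2) / (2 * Real.sinh (r / 2))) ^ 2 *
          (1 / (2 * Real.sinh (r / 2) * Real.cosh (r / 2))) +
        (Real.cosh (r / 2) / (2 * Real.sinh (r / 2))) * ((1 + 2 * Real.sinh (r / 2) ^ 2) /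
          (2 * Real.sinh (r / 2) * Real.cosh (r / 2)) ^ 2)) := by
        gcongr
    _ = _ := by
        generalize Real.sinh (r / 2) = s at *
        generalize Real.cosh (r / 2) = c at *
        have hs2 : s ^ 2 = c ^ 2 - 1 := by linarith
        field_simp
        rw [hs2]
        linear_combination 4 * (s ^ 2 + c ^ 2 - 1) * hs2

theorem integral_Ghalf_le {ρ : ℝ} (hρ : 0 < ρ) :
    ∫ r in Set.Ioi ρ, (1 / Real.sqrt (Real.cosh r - Real.cosh ρ)) *
        (1 / (r ^ 2 * Real.sinh r) + Real.cosh r / (r * Real.sinh r ^ 2)) ≤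
      1 / (4 * Real.sqrt 2) * (π / 2 * (1 / Real.sinh (ρ / 2) ^ 3 + 1 / Real.sinh (ρ / 2))
        - π / 2 / Real.cosh (ρ / 2)) := by
  have hσ : 0 < Real.sinh (ρ / 2) := Real.sinh_pos_iff.2 (by linarith)
  have hκ := Real.cosh_pos (ρ / 2)
  have hκσ : Real.cosh (ρ / 2) ^ 2 = 1 + Real.sinh (ρ / 2) ^ 2 := by rw [Real.cosh_sq]; ring
  have hcont : ContinuousWithinAt
      (majorantPrimitive (Real.sinh (ρ / 2)) (Real.cosh (ρ / 2))) (Set.Ici ρ) ρ := by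
    have := continuous_radial (Real.sinh (ρ / 2))
    refine ContinuousAt.continuousWithinAt ?_
    unfold majorantPrimitive
    fun_prop (disch := positivity)
  have hderiv : ∀ r ∈ Set.Ioi ρ, HasDerivAt
      (majorantPrimitive (Real.sinh (ρ / 2)) (Real.cosh (ρ / 2)))
      (majorant (Real.sinh (ρ / 2)) r) r := fun r hr =>
    hasDerivAt_majorantPrimitive hσ hκ hκσ
      (Real.sinh_lt_sinh.2 (by have := Set.mem_Ioi.1 hr; linarith))
  have hnn : ∀ r ∈ Set.Ioi ρ, 0 ≤ majorant (Real.sinh (ρ / 2)) r := fun r hr =>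
    majorant_nonneg (hρ.trans hr)
  have hlim := tendsto_majorantPrimitive hσ hκ
  have hint := integrableOn_Ioi_deriv_of_nonneg hcont hderiv hnn hlim
  have hval := integral_Ioi_of_hasDerivAt_of_nonneg hcont hderiv hnn hlim
  have h0 : majorantPrimitive (Real.sinh (ρ / 2)) (Real.cosh (ρ / 2)) ρ = 0 := by
    simp [majorantPrimitive, radial]
  rw [h0, sub_zero] at hval
  rw [← hval, ← integral_const_mul]
  refine integral_mono_of_nonneg ?_ (hint.const_mul _) ?_
  · filter_upwards [ae_restrict_mem measurableSet_Ioi] with r hr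
    have hr0 : 0 < r := hρ.trans hr
    have hs : 0 < Real.sinh r := Real.sinh_pos_iff.2 hr0
    have hc := Real.cosh_pos r
    simp only [Pi.zero_apply]
    positivity
  · filter_upwards [ae_restrict_mem measurableSet_Ioi] with r hr
    exact Ghalf_integrand_le hρ hr

theorem Ghalf_constant_eq :
    2 / (Real.sqrt π * (2 * π) ^ ((5 : ℝ) / 2)) = 1 / (2 * Real.sqrt 2 * π ^ 3) := by
  have h : (2 * π) ^ ((5 : ℝ) / 2) = (2 * π) ^ 2 * (Real.sqrt 2 * Real.sqrt π) := by
    rw [show (5 : ℝ) / 2 = (2 : ℕ) + 1 / 2 by norm_num,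
      Real.rpow_add (by positivity), Real.rpow_natCast, ← Real.sqrt_eq_rpow,
      Real.sqrt_mul zero_le_two]
  have hπ : Real.sqrt π * Real.sqrt π = π := Real.mul_self_sqrt pi_pos.le
  have e : Real.sqrt π * ((2 * π) ^ 2 * (Real.sqrt 2 * Real.sqrt π))
      = 4 * Real.sqrt 2 * π ^ 3 := by
    linear_combination (4 * π ^ 2 * Real.sqrt 2) * hπ
  rw [h, e]
  field_simp
  norm_num

theorem Ghalf_estimate_one (ρ : ℝ) (hρ : 0 < ρ) :
    Ghalf ρ ≤ 1 / (16 * π ^ 2 * (1 + Real.cosh ρ) * Real.sinh (ρ / 2) ^ 3)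
      + Real.sqrt 2 / (4 * π ^ 2 * Real.sqrt (1 + Real.cosh ρ) * Real.sinh ρ) := by
  have hσ : 0 < Real.sinh (ρ / 2) := Real.sinh_pos_iff.2 (by linarith)
  have hκ := Real.cosh_pos (ρ / 2)
  have hκσ := Real.cosh_sq (ρ / 2)
  have hcosh : 1 + Real.cosh ρ = 2 * Real.cosh (ρ / 2) ^ 2 := by
    have := Real.cosh_two_mul (ρ / 2)
    rw [mul_div_cancel₀ ρ two_ne_zero] at this
    linarith
  have hsinh : Real.sinh ρ = 2 * Real.sinh (ρ / 2) * Real.cosh (ρ / 2) := by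
    rw [← Real.sinh_two_mul, mul_div_cancel₀ ρ two_ne_zero]
  have hsqrt : Real.sqrt (1 + Real.cosh ρ) = Real.sqrt 2 * Real.cosh (ρ / 2) := by
    rw [hcosh, Real.sqrt_mul zero_le_two, Real.sqrt_sq hκ.le]
  have h2 : Real.sqrt 2 * Real.sqrt 2 = 2 := Real.mul_self_sqrt zero_le_two
  have hlt := Real.sinh_lt_cosh (ρ / 2)
  rw [hsqrt, hcosh, hsinh, Ghalf, Ghalf_constant_eq]
  refine (mul_le_mul_of_nonneg_left (integral_Ghalf_le hρ) (by positivity)).trans ?_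
  generalize Real.sinh (ρ / 2) = s at *
  generalize Real.cosh (ρ / 2) = c at *
  have hl : 1 / (2 * Real.sqrt 2 * π ^ 3) * (1 / (4 * Real.sqrt 2) *
      (π / 2 * (1 / s ^ 3 + 1 / s) - π / 2 / c)) =
      (c ^ 2 * (1 + s ^ 2) - s ^ 3 * c) / (32 * π ^ 2 * c ^ 2 * s ^ 3) := by
    have : Real.sqrt 2 ^ 2 = 2 := by rw [sq, h2]
    field_simp
    rw [this]
    ring
  have hrhs : 1 / (16 * π ^ 2 * (2 * c ^ 2) * s ^ 3) +
      Real.sqrt 2 / (4 * π ^ 2 * (Real.sqrt 2 * c) * (2 * s * c)) =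
      (1 + 4 * s ^ 2) / (32 * π ^ 2 * c ^ 2 * s ^ 3) := by
    field_simp
    ring
  rw [hl, hrhs]
  gcongr
  have h3 : s ^ 3 * s ≤ s ^ 3 * c := by gcongr
  rw [hκσ]
  nlinarith [sq_nonneg s]
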